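/- Let V be a finite set and g : 2^V → [0,1] a set function. If g is AD-k as a set function, then the multilinear extension G of g is AD-k as a continuous function on [0,1]^V. -/

import Mathlib

open MeasureTheory Finset
open scoped Classical

noncomputable section


/-- The difference of a set function `f` over a set `A`, evaluated at `S`:
`Δ_A f(S) = ∑_{B ⊆ A} (-1)^{|B|} f(S ∪ (A \ B))`. -/
def adDiff {V : Type*} [DecidableEq V] (f : Finset V → ℝ) (A S : Finset V) : ℝ :=
  ∑ B ∈ A.powerset, (-1 : ℝ) ^ B.card * f (S ∪ (A \ B))

/-- A set function `f : 2^V → ℝ` is AD-`k` if `(-1)^{|A|+1} Δ_A f(S) ≥ 0` for every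
nonempty `A` with `|A| ≤ k` and every `S`. -/
def IsADk {V : Type*} [DecidableEq V] (f : Finset V → ℝ) (k : ℕ) : Prop :=
  ∀ A S : Finset V, A.Nonempty → A.card ≤ k →
    0 ≤ (-1 : ℝ) ^ (A.card + 1) * adDiff f A S



/-- The partial derivative of `F : ℝ^ι → ℝ` in the `i`-th coordinate direction. -/
def pderivI {ι : Type*} [Fintype ι] [DecidableEq ι] (i : ι) (F : (ι → ℝ) → ℝ) :
    (ι → ℝ) → ℝ :=
  fun x => fderiv ℝ F x (Pi.single i 1)

/-- Iterated mixed partial derivative of `F` along a list of coordinate indices. -/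
def mixedPartial {ι : Type*} [Fintype ι] [DecidableEq ι] (F : (ι → ℝ) → ℝ) :
    List ι → (ι → ℝ) → ℝ
  | [] => F
  | i :: l => pderivI i (mixedPartial F l)

/-- A function `F : ℝ^ι → ℝ` is AD-`k` as a continuous function if for every `1 ≤ ℓ ≤ k`,
every `ℓ` pairwise distinct coordinates `i_1, …, i_ℓ`, and every `x ∈ [0,1]^ι`,
`(-1)^{ℓ+1} ∂^ℓ F(x)/∂x_{i_1}⋯∂x_{i_ℓ} ≥ 0`. -/
def IsADkC {ι : Type*} [Fintype ι] [DecidableEq ι] (F : (ι → ℝ) → ℝ) (k : ℕ) : Prop :=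
  ∀ l : List ι, l ≠ [] → l.length ≤ k → l.Nodup →
    ∀ x : ι → ℝ, (∀ i, x i ∈ Set.Icc (0 : ℝ) 1) →
      0 ≤ (-1 : ℝ) ^ (l.length + 1) * mixedPartial F l x


def mlExt {V : Type*} [Fintype V] [DecidableEq V] (h : Finset V → ℝ) (x : V → ℝ) : ℝ :=
  ∑ T ∈ (Finset.univ : Finset V).powerset,
    (∏ v ∈ T, x v) * (∏ v ∈ Finset.univ \ T, (1 - x v)) * h T

lemma mlExt_split {V : Type*} [Fintype V] [DecidableEq V] (h : Finset V → ℝ) (i : V)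
    (x : V → ℝ) :
    mlExt h x = ∑ T ∈ ((Finset.univ : Finset V).erase i).powerset,
      (∏ v ∈ T, x v) * (∏ v ∈ (Finset.univ.erase i) \ T, (1 - x v)) *
        ((1 - x i) * h T + x i * h (insert i T)) := by
  unfold mlExt
  have hu : (Finset.univ : Finset V) = insert i (Finset.univ.erase i) := by simp
  conv_lhs => rw [hu]
  rw [Finset.sum_powerset_insert (by simp), ← Finset.sum_add_distrib]
  refine Finset.sum_congr rfl fun T hT => ?_
  have hiT : i ∉ T := fun hi => by
    have := Finset.mem_powerset.1 hT hi
    simp at this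
  have e1 : insert i (Finset.univ.erase i) \ T = insert i (Finset.univ.erase i \ T) :=
    Finset.insert_sdiff_of_notMem _ hiT
  have e2 : insert i (Finset.univ.erase i) \ insert i T = Finset.univ.erase i \ T := by
    ext v
    by_cases hv : v = i <;> simp [hv]
  rw [e1, e2, Finset.prod_insert (by simp), Finset.prod_insert hiT]
  ring

lemma mlExt_line {V : Type*} [Fintype V] [DecidableEq V] (h : Finset V → ℝ) (i : V)
    (x : V → ℝ) (t : ℝ) :
    mlExt h (x + t • Pi.single i 1) =
      mlExt h x + t * mlExt (fun T => h (insert i T) - h (T.erase i)) x := by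
  rw [mlExt_split h i, mlExt_split h i, mlExt_split _ i x, Finset.mul_sum,
    ← Finset.sum_add_distrib]
  refine Finset.sum_congr rfl fun T hT => ?_
  have hiT : i ∉ T := fun hi => by
    have := Finset.mem_powerset.1 hT hi
    simp at this
  have e1 : ∏ v ∈ T, (x + t • (Pi.single i 1 : V → ℝ)) v = ∏ v ∈ T, x v := by
    refine Finset.prod_congr rfl fun v hv => ?_
    have : v ≠ i := fun hh => hiT (hh ▸ hv)
    simp [this]
  have e2 : ∏ v ∈ Finset.univ.erase i \ T, (1 - (x + t • (Pi.single i 1 : V → ℝ)) v) =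
      ∏ v ∈ Finset.univ.erase i \ T, (1 - x v) := by
    refine Finset.prod_congr rfl fun v hv => ?_
    have : v ≠ i := by
      simp at hv
      exact hv.1
    simp [this]
  rw [e1, e2, Finset.erase_eq_of_notMem hiT, Finset.erase_insert hiT, Finset.insert_idem]
  simp
  ring

lemma pderivI_mlExt {V : Type*} [Fintype V] [DecidableEq V] (h : Finset V → ℝ) (i : V) :
    pderivI i (mlExt h) = mlExt (fun T => h (insert i T) - h (T.erase i)) := by
  funext x
  have hd : DifferentiableAt ℝ (mlExt h) x := by
    unfold mlExt
    fun_prop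
  unfold pderivI
  rw [← hd.lineDeriv_eq_fderiv]
  unfold lineDeriv
  simp_rw [mlExt_line]
  simp

lemma adDiff_insert {V : Type*} [DecidableEq V] (g : Finset V → ℝ) (A S : Finset V) (i : V)
    (hA : i ∉ A) :
    adDiff g (insert i A) S = adDiff g A (insert i S) - adDiff g A S := by
  unfold adDiff
  rw [Finset.sum_powerset_insert hA, sub_eq_add_neg, ← Finset.sum_neg_distrib]
  congr 1
  · refine Finset.sum_congr rfl fun B hB => ?_
    have hiB : i ∉ B := fun hi => hA (Finset.mem_powerset.1 hB hi)
    rw [Finset.insert_sdiff_of_notMem _ hiB, Finset.union_insert, Finset.insert_union]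
  · refine Finset.sum_congr rfl fun B hB => ?_
    have hiB : i ∉ B := fun hi => hA (Finset.mem_powerset.1 hB hi)
    have e : insert i A \ insert i B = A \ B := by
      ext v
      by_cases hv : v = i <;> simp [hv, hA]
    rw [e, Finset.card_insert_of_notMem hiB, pow_succ]
    ring

lemma mixedPartial_mlExt {V : Type*} [Fintype V] [DecidableEq V] (g : Finset V → ℝ)
    (l : List V) (hl : l.Nodup) :
    mixedPartial (mlExt g) l = mlExt (fun T => adDiff g l.toFinset (T \ l.toFinset)) := by
  induction l with
  | nil => simp [mixedPartial, adDiff]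
  | cons i l ih =>
    obtain ⟨hi, hl⟩ := List.nodup_cons.1 hl
    have hA : i ∉ l.toFinset := by simpa using hi
    rw [mixedPartial, ih hl, pderivI_mlExt]
    congr 1
    funext T
    rw [List.toFinset_cons, adDiff_insert _ _ _ _ hA]
    congr 2
    · ext v
      by_cases hv : v = i <;> simp [hv, hi]
    · ext v
      by_cases hv : v = i <;> simp [hv]

/-- If a set function `g : 2^V → [0,1]` is AD-`k`, then its multilinear extension
`G(x) = ∑_{T ⊆ V} ∏_{v ∈ T} x_v ∏_{v ∉ T} (1 - x_v) g(T)` is AD-`k` as a continuous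
function on `[0,1]^V`. -/
theorem multilinear_extension_ADk
    {V : Type*} [Fintype V] [DecidableEq V]
    (g : Finset V → ℝ) (hg0 : ∀ T, 0 ≤ g T) (hg1 : ∀ T, g T ≤ 1)
    (k : ℕ) (hg : IsADk g k) :
    IsADkC (fun x : V → ℝ =>
      ∑ T ∈ (Finset.univ : Finset V).powerset,
        (∏ v ∈ T, x v) * (∏ v ∈ Finset.univ \ T, (1 - x v)) * g T) k := by
  intro l hne hlk hnd x hx
  change 0 ≤ (-1 : ℝ) ^ (l.length + 1) * mixedPartial (mlExt g) l x
  rw [mixedPartial_mlExt g l hnd, mlExt, Finset.mul_sum]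
  refine Finset.sum_nonneg fun T _ => ?_
  have h1 : 0 ≤ ∏ v ∈ T, x v := Finset.prod_nonneg fun v _ => (hx v).1
  have h2 : 0 ≤ ∏ v ∈ Finset.univ \ T, (1 - x v) :=
    Finset.prod_nonneg fun v _ => sub_nonneg.2 (hx v).2
  have hc : l.toFinset.card = l.length := List.toFinset_card_of_nodup hnd
  have h3 := hg l.toFinset (T \ l.toFinset) (List.toFinset_nonempty_iff l |>.2 hne)
    (hc ▸ hlk)
  rw [hc] at h3
  rw [mul_left_comm]
  exact mul_nonneg (mul_nonneg h1 h2) h3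

end
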